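/- Fix T > 0, ρ ∈ (0,1), χ = ρ(1−ρ), and α ∈ ℝ. For ψ ∈ C²_c(ℝ) and H ∈ C^{1,2}_c([0,T]×ℝ), define the net macroscopic current 𝒞(t; ψ, H) = ∫₀ᵗ ∫_ℝ [ −(1/2) p'_s(v) ψ(v) + χ p_{t−s}(v) ∂_v H(s,v) ] dv ds for 0 < t ≤ T. Then the infimum of ‖ψ‖²_{L²(ℝ)}/(2χ) + (χ/2) ∫₀ᵀ∫_ℝ (∂_u H(t,u))² du dt over all ψ ∈ C²_c(ℝ) and H ∈ C^{1,2}_c([0,T]×ℝ) with 𝒞(T; ψ, H) = α equals √(2π) α² / (4χ√T). -/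

import Mathlib

open Real MeasureTheory

/-- The one-dimensional heat kernel `p_t(u) = (2πt)^{-1/2} exp(-u²/(2t))`. -/
noncomputable def heatK (t u : ℝ) : ℝ := Real.exp (-(u ^ 2) / (2 * t)) / Real.sqrt (2 * π * t)

/-- The spatial derivative of the heat kernel: `p'_t(u) = -(u/t) p_t(u)`. -/
noncomputable def heatK' (t u : ℝ) : ℝ := -(u / t) * heatK t u

/-- The net macroscopic current
`𝒞(t; ψ, H) = ∫₀ᵗ ∫_ℝ [ −(1/2) p'_s(v) ψ(v) + χ p_{t−s}(v) ∂_v H(s,v) ] dv ds`. -/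
noncomputable def netCurrent (χ t : ℝ) (ψ : ℝ → ℝ) (H : ℝ → ℝ → ℝ) : ℝ :=
  ∫ s in (0:ℝ)..t, ∫ v, (-(1/2) * heatK' s v * ψ v + χ * heatK (t - s) v * deriv (H s) v)

/-! ### Gaussian computations -/

lemma ri_int_sq_exp {b : ℝ} (hb : 0 < b) : Integrable (fun x : ℝ => x ^ 2 * rexp (-b * x ^ 2)) := by
  have := integrable_rpow_mul_exp_neg_mul_sq hb (by norm_num : (-1:ℝ) < 2)
  simpa using this

lemma ri_integral_sq_exp {b : ℝ} (hb : 0 < b) :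
    ∫ x : ℝ, x ^ 2 * rexp (-b * x ^ 2) = √(π / b) / (2 * b) := by
  have h1 : ∀ x : ℝ, HasDerivAt (fun x : ℝ => x * rexp (-b * x ^ 2))
      (rexp (-b * x ^ 2) - 2 * b * (x ^ 2 * rexp (-b * x ^ 2))) x := by
    intro x
    have h := (hasDerivAt_id x).mul (((hasDerivAt_pow 2 x).const_mul (-b)).exp)
    refine h.congr_deriv ?_
    simp; ring
  have h2 := integral_eq_zero_of_hasDerivAt_of_integrable h1
    ((integrable_exp_neg_mul_sq hb).sub ((ri_int_sq_exp hb).const_mul (2 * b)))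
    (integrable_mul_exp_neg_mul_sq hb)
  rw [integral_sub (integrable_exp_neg_mul_sq hb) ((ri_int_sq_exp hb).const_mul (2 * b)),
    integral_const_mul, integral_gaussian] at h2
  rw [eq_div_iff (by positivity)]
  linarith

/-- `k_s(v) = -(1/2) p'_s(v)`. -/
noncomputable def riK (s v : ℝ) : ℝ := -(1/2) * heatK' s v

lemma ri_meas_heatK : Measurable (fun q : ℝ × ℝ => heatK q.1 q.2) := by
  unfold heatK; fun_prop

lemma ri_meas_heatK_sub (T : ℝ) : Measurable (fun q : ℝ × ℝ => heatK (T - q.1) q.2) :=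
  ri_meas_heatK.comp (by fun_prop : Measurable fun q : ℝ × ℝ => (T - q.1, q.2))

lemma ri_meas_K : Measurable (fun q : ℝ × ℝ => riK q.1 q.2) := by
  unfold riK heatK' heatK; fun_prop

lemma ri_KK {s t : ℝ} (hs : 0 < s) (ht : 0 < t) (v : ℝ) :
    riK s v * riK t v = (1 / (4 * s * t * (√(2 * π * s) * √(2 * π * t)))) *
      (v ^ 2 * rexp (-((s + t) / (2 * s * t)) * v ^ 2)) := by
  have : rexp (-((s + t) / (2 * s * t)) * v ^ 2)
      = rexp (-(v ^ 2) / (2 * s)) * rexp (-(v ^ 2) / (2 * t)) := by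
    rw [← Real.exp_add]; congr 1; field_simp; ring
  rw [this]
  unfold riK heatK' heatK
  field_simp; ring

lemma ri_KK_int {s t : ℝ} (hs : 0 < s) (ht : 0 < t) :
    Integrable (fun v => riK s v * riK t v) := by
  simp_rw [ri_KK hs ht]
  exact (ri_int_sq_exp (by positivity)).const_mul _

lemma ri_KK_nonneg {s t : ℝ} (hs : 0 < s) (ht : 0 < t) (v : ℝ) : 0 ≤ riK s v * riK t v := by
  rw [ri_KK hs ht]; positivity

lemma ri_KK_integral {s t : ℝ} (hs : 0 < s) (ht : 0 < t) :
    ∫ v, riK s v * riK t v = 1 / (4 * √(2 * π)) * (s + t) ^ (-(3/2) : ℝ) := by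
  simp_rw [ri_KK hs ht]
  rw [integral_const_mul, ri_integral_sq_exp (by positivity)]
  have hst : 0 < s + t := by positivity
  have e1 : (s + t) ^ (-(3/2) : ℝ) = 1 / ((s + t) * √(s + t)) := by
    rw [Real.rpow_neg hst.le, show (3/2:ℝ) = 1 + 1/2 by norm_num, Real.rpow_add hst,
      Real.rpow_one, ← Real.sqrt_eq_rpow, one_div]
  have e2 : π / ((s + t) / (2 * s * t)) = 2 * π * s * t / (s + t) := by field_simp
  rw [e1, e2, Real.sqrt_div (by positivity), Real.sqrt_mul (by positivity : 0 ≤ 2 * π * s) t,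
    Real.sqrt_mul (by positivity : 0 ≤ 2 * π) s, Real.sqrt_mul (by positivity : 0 ≤ 2 * π) t]
  have h1 : √s ≠ 0 := by positivity
  have h2 : √t ≠ 0 := by positivity
  have h3 : √(2*π) ≠ 0 := by positivity
  have h4 : √(s+t) ≠ 0 := by positivity
  field_simp

lemma ri_heat_sq {s : ℝ} (hs : 0 < s) (v : ℝ) :
    heatK s v ^ 2 = (1 / (2 * π * s)) * rexp (-(1 / s) * v ^ 2) := by
  unfold heatK
  rw [div_pow, Real.sq_sqrt (by positivity), ← Real.exp_nat_mul, one_div_mul_eq_div]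
  congr 2
  push_cast; field_simp

lemma ri_heat_sq_int {s : ℝ} (hs : 0 < s) : Integrable (fun v => heatK s v ^ 2) := by
  simp_rw [ri_heat_sq hs]
  exact (integrable_exp_neg_mul_sq (by positivity)).const_mul _

lemma ri_heat_sq_integral {s : ℝ} (hs : 0 < s) :
    ∫ v, heatK s v ^ 2 = 1 / (2 * √π) * s ^ (-(1/2) : ℝ) := by
  simp_rw [ri_heat_sq hs]
  rw [integral_const_mul, integral_gaussian, Real.rpow_neg hs.le, ← Real.sqrt_eq_rpow]
  have h1 : √s ≠ 0 := by positivity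
  have h3 : √π ≠ 0 := by positivity
  have e2 : π / (1 / s) = π * s := by field_simp
  rw [e2, Real.sqrt_mul (by positivity)]
  have : s = √s ^ 2 := (Real.sq_sqrt hs.le).symm
  have hpi : π = √π ^ 2 := (Real.sq_sqrt Real.pi_pos.le).symm
  rw [show 1 / (2 * π * s) * (√π * √s) = 1 / (2 * √π ^ 2 * √s ^ 2) * (√π * √s) by
    rw [← this, ← hpi]]
  field_simp

lemma ri_K_abs_le {s : ℝ} (hs : 0 < s) (v : ℝ) :
    |riK s v| ≤ (1 / (2 * √s * √(2 * π * s))) * rexp (-(1 / (4 * s)) * v ^ 2) := by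
  have h1 : |v| ≤ √s * rexp (1 / (4 * s) * v ^ 2) := by
    have hss : 0 < √s := by positivity
    have h := Real.add_one_le_exp (1 / (4 * s) * v ^ 2)
    have h' : |v| ≤ √s * (1 / (4 * s) * v ^ 2 + 1) := by
      rw [← sq_abs v, ← Real.sq_sqrt hs.le, Real.sqrt_sq hss.le]
      have := sq_nonneg (|v| / (2 * √s) - 1)
      have e : √s * (1 / (4 * √s ^ 2) * |v| ^ 2 + 1) - |v| = √s * (|v| / (2 * √s) - 1) ^ 2 := by
        field_simp; ring
      nlinarith [mul_nonneg hss.le this]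
    exact h'.trans (by gcongr)
  have e : rexp (-(1 / (4 * s)) * v ^ 2) = rexp (1 / (4 * s) * v ^ 2) * rexp (-(v ^ 2) / (2 * s)) := by
    rw [← Real.exp_add]; congr 1; field_simp; ring
  have e2 : |riK s v| = |v| / (2 * s) * (rexp (-(v ^ 2) / (2 * s)) / √(2 * π * s)) := by
    have : riK s v = v / (2 * s) * (rexp (-(v ^ 2) / (2 * s)) / √(2 * π * s)) := by
      unfold riK heatK' heatK; field_simp
    rw [this, abs_mul, abs_div, abs_of_pos (by positivity : 0 < 2 * s),
      abs_of_pos (by positivity : 0 < rexp (-(v ^ 2) / (2 * s)) / √(2 * π * s))]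
  rw [e2, e]
  calc _ ≤ (√s * rexp (1 / (4 * s) * v ^ 2)) / (2 * s) * (rexp (-(v ^ 2) / (2 * s)) / √(2 * π * s)) := by
        gcongr
    _ = _ := by
        have hss : √s ≠ 0 := by positivity
        have : s = √s ^ 2 := (Real.sq_sqrt hs.le).symm
        rw [show √s * rexp (1 / (4 * s) * v ^ 2) / (2 * s) = rexp (1 / (4 * s) * v ^ 2) / (2 * √s) by
          rw [div_eq_div_iff (by positivity) (by positivity)]
          rw [show √s * rexp (1 / (4 * s) * v ^ 2) * (2 * √s)
            = rexp (1 / (4 * s) * v ^ 2) * (2 * √s ^ 2) by ring, ← this]]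
        field_simp

lemma ri_K_int {s : ℝ} (hs : 0 < s) : Integrable (fun v => riK s v) := by
  refine Integrable.mono' ((integrable_exp_neg_mul_sq (b := 1 / (4 * s)) (by positivity)).const_mul
    (1 / (2 * √s * √(2 * π * s)))) ?_ (.of_forall fun v => ri_K_abs_le hs v)
  exact (ri_meas_K.comp (by fun_prop : Measurable fun v : ℝ => (s, v))).aestronglyMeasurable

lemma ri_K_integral_abs {s : ℝ} (hs : 0 < s) :
    ∫ v, |riK s v| ≤ s ^ (-(1/2) : ℝ) := by
  have h := integral_mono (ri_K_int hs).abs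
    ((integrable_exp_neg_mul_sq (b := 1 / (4 * s)) (by positivity)).const_mul
    (1 / (2 * √s * √(2 * π * s)))) (ri_K_abs_le hs)
  refine h.trans ?_
  rw [integral_const_mul, integral_gaussian, Real.rpow_neg hs.le, ← Real.sqrt_eq_rpow]
  have e : π / (1 / (4 * s)) = 2 * (2 * π * s) := by field_simp; ring
  rw [e, Real.sqrt_mul (by norm_num : (0:ℝ) ≤ 2) (2 * π * s)]
  have hss : √s ≠ 0 := by positivity
  have : √(2 * π * s) ≠ 0 := by positivity
  have h2 : √2 ≤ 2 := by
    rw [Real.sqrt_le_left (by norm_num)]; norm_num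
  rw [show 1 / (2 * √s * √(2 * π * s)) * (√2 * √(2 * π * s)) = (√2 / 2) * (√s)⁻¹ by field_simp]
  have : 0 ≤ (√s)⁻¹ := by positivity
  nlinarith

/-! ### Product integrals -/

/-- Lebesgue measure on `(0,T]`. -/
noncomputable abbrev riN (T : ℝ) : Measure ℝ := volume.restrict (Set.Ioc 0 T)

/-- The kernel `g_T(v) = ∫_0^T k_s(v) ds`. -/
noncomputable def riG (T v : ℝ) : ℝ := ∫ s, riK s v ∂(riN T)

lemma ri_ae_pos (T : ℝ) : ∀ᵐ s ∂(riN T), 0 < s ∧ s < T := by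
  have h1 : ∀ᵐ s ∂(riN T), s ∈ Set.Ioc 0 T := ae_restrict_mem measurableSet_Ioc
  have h2 : ∀ᵐ s ∂(riN T), s ≠ T :=
    ae_restrict_of_ae (by simp [ae_iff])
  filter_upwards [h1, h2] with s h h'
  exact ⟨h.1, lt_of_le_of_ne h.2 h'⟩

lemma ri_int_rpow {T : ℝ} (hT : 0 < T) : Integrable (fun s : ℝ => s ^ (-(1/2) : ℝ)) (riN T) := by
  have := intervalIntegral.intervalIntegrable_rpow' (a := 0) (b := T) (r := -(1/2)) (by norm_num)
  rwa [intervalIntegrable_iff_integrableOn_Ioc_of_le hT.le] at this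

lemma ri_int_rpow_sub {T : ℝ} (hT : 0 < T) :
    Integrable (fun s : ℝ => (T - s) ^ (-(1/2) : ℝ)) (riN T) := by
  have := (intervalIntegral.intervalIntegrable_rpow' (a := 0) (b := T) (r := -(1/2))
    (by norm_num)).comp_sub_left T
  simp only [sub_zero, sub_self] at this
  have := this.symm
  rwa [intervalIntegrable_iff_integrableOn_Ioc_of_le hT.le] at this

lemma ri_integral_rpow (a b : ℝ) :
    ∫ s in a..b, s ^ (-(1/2) : ℝ) = 2 * (b ^ (1/2 : ℝ) - a ^ (1/2 : ℝ)) := by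
  rw [integral_rpow (Or.inl (by norm_num))]
  norm_num
  ring

lemma ri_p_int {T : ℝ} (hT : 0 < T) :
    Integrable (fun q : ℝ × ℝ => heatK (T - q.1) q.2 ^ 2) ((riN T).prod volume) := by
  rw [integrable_prod_iff ((ri_meas_heatK_sub T).pow_const 2).aestronglyMeasurable]
  constructor
  · filter_upwards [ri_ae_pos T] with s hs
    exact ri_heat_sq_int (by linarith)
  · refine ((ri_int_rpow_sub hT).const_mul (1 / (2 * √π))).congr ?_
    filter_upwards [ri_ae_pos T] with s hs
    simp only [norm_pow, Real.norm_eq_abs, sq_abs]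
    rw [ri_heat_sq_integral (by linarith)]

lemma ri_p_integral {T : ℝ} (hT : 0 < T) :
    ∫ q : ℝ × ℝ, heatK (T - q.1) q.2 ^ 2 ∂((riN T).prod volume) = √T / √π := by
  rw [integral_prod _ (ri_p_int hT)]
  dsimp only
  have : ∫ s, (∫ v, heatK (T - s) v ^ 2) ∂(riN T)
      = ∫ s, 1 / (2 * √π) * (T - s) ^ (-(1/2) : ℝ) ∂(riN T) := by
    refine integral_congr_ae ?_
    filter_upwards [ri_ae_pos T] with s hs
    rw [ri_heat_sq_integral (by linarith)]
  rw [this, integral_const_mul, ← intervalIntegral.integral_of_le hT.le,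
    intervalIntegral.integral_comp_sub_left (fun x => x ^ (-(1/2) : ℝ)), ri_integral_rpow,
    Real.sqrt_eq_rpow T]
  simp
  field_simp

lemma ri_Kprod_int {T : ℝ} (hT : 0 < T) :
    Integrable (fun q : ℝ × ℝ => riK q.1 q.2) ((riN T).prod volume) := by
  rw [integrable_prod_iff ri_meas_K.aestronglyMeasurable]
  constructor
  · filter_upwards [ri_ae_pos T] with s hs
    exact ri_K_int hs.1
  · refine (ri_int_rpow hT).mono' ?_ ?_
    · exact ri_meas_K.norm.stronglyMeasurable.integral_prod_right.aestronglyMeasurable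
    · filter_upwards [ri_ae_pos T] with s hs
      rw [Real.norm_of_nonneg (integral_nonneg fun _ => norm_nonneg _)]
      exact ri_K_integral_abs hs.1

lemma ri_inner_time {T s : ℝ} (hT : 0 < T) (hs : 0 < s) :
    Integrable (fun t : ℝ => (s + t) ^ (-(3/2) : ℝ)) (riN T) ∧
    ∫ t, (s + t) ^ (-(3/2) : ℝ) ∂(riN T) = 2 * (s ^ (-(1/2) : ℝ) - (s + T) ^ (-(1/2) : ℝ)) := by
  have h0 : (0:ℝ) ∉ Set.uIcc (s + 0) (s + T) := by
    rw [Set.uIcc_of_le (by linarith)]; intro h; have := h.1; linarith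
  constructor
  · have h := (intervalIntegral.intervalIntegrable_rpow (μ := volume) (r := -(3/2)) (Or.inr h0)).comp_add_left s
    simp only [add_sub_cancel_left] at h
    rwa [intervalIntegrable_iff_integrableOn_Ioc_of_le hT.le] at h
  · rw [← intervalIntegral.integral_of_le hT.le,
      intervalIntegral.integral_comp_add_left (fun x => x ^ (-(3/2) : ℝ)),
      integral_rpow (Or.inr ⟨by norm_num, h0⟩)]
    norm_num
    ring

lemma ri_int_rpow_add {T : ℝ} (hT : 0 < T) :
    Integrable (fun s : ℝ => (s + T) ^ (-(1/2) : ℝ)) (riN T) := by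
  have := (intervalIntegral.intervalIntegrable_rpow' (a := 0 + T) (b := T + T) (r := -(1/2))
    (by norm_num)).comp_add_right T
  simp only [add_sub_cancel_right] at this
  rwa [intervalIntegrable_iff_integrableOn_Ioc_of_le hT.le] at this

lemma ri_ae_pos_prod (T : ℝ) : ∀ᵐ q ∂((riN T).prod (riN T)), 0 < q.1 ∧ 0 < q.2 := by
  have h1 := Measure.quasiMeasurePreserving_fst (μ := riN T) (ν := riN T) |>.ae (ri_ae_pos T)
  have h2 := Measure.quasiMeasurePreserving_snd (μ := riN T) (ν := riN T) |>.ae (ri_ae_pos T)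
  filter_upwards [h1, h2] with q h h'
  exact ⟨h.1, h'.1⟩

lemma ri_time_int {T : ℝ} (hT : 0 < T) :
    Integrable (fun q : ℝ × ℝ => (q.1 + q.2) ^ (-(3/2) : ℝ)) ((riN T).prod (riN T)) := by
  rw [integrable_prod_iff (by
    have : Measurable (fun q : ℝ × ℝ => (q.1 + q.2) ^ (-(3/2) : ℝ)) := by fun_prop
    exact this.aestronglyMeasurable)]
  constructor
  · filter_upwards [ri_ae_pos T] with s hs
    exact (ri_inner_time hT hs.1).1
  · refine (((ri_int_rpow hT).sub (ri_int_rpow_add hT)).const_mul 2).congr ?_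
    filter_upwards [ri_ae_pos T] with s hs
    simp only [Pi.sub_apply]
    rw [← (ri_inner_time hT hs.1).2]
    refine integral_congr_ae ?_
    filter_upwards [ri_ae_pos T] with t ht
    rw [Real.norm_of_nonneg (Real.rpow_nonneg (by linarith [hs.1, ht.1]) _)]

lemma ri_time_integral {T : ℝ} (hT : 0 < T) :
    ∫ q : ℝ × ℝ, (q.1 + q.2) ^ (-(3/2) : ℝ) ∂((riN T).prod (riN T)) = 4 * √T * (2 - √2) := by
  rw [integral_prod _ (ri_time_int hT)]
  have : ∫ s, ∫ t, (s + t) ^ (-(3/2) : ℝ) ∂(riN T) ∂(riN T)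
      = ∫ s, 2 * (s ^ (-(1/2) : ℝ) - (s + T) ^ (-(1/2) : ℝ)) ∂(riN T) := by
    refine integral_congr_ae ?_
    filter_upwards [ri_ae_pos T] with s hs
    rw [(ri_inner_time hT hs.1).2]
  rw [this, integral_const_mul, integral_sub (ri_int_rpow hT) (ri_int_rpow_add hT),
    ← intervalIntegral.integral_of_le hT.le, ← intervalIntegral.integral_of_le hT.le,
    intervalIntegral.integral_comp_add_right (fun x => x ^ (-(1/2) : ℝ)), ri_integral_rpow,
    ri_integral_rpow, ← Real.sqrt_eq_rpow, ← Real.sqrt_eq_rpow, ← Real.sqrt_eq_rpow,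
    ← Real.sqrt_eq_rpow, ← two_mul T, Real.sqrt_mul (by norm_num)]
  simp
  ring

lemma ri_triple {T : ℝ} (hT : 0 < T) :
    Integrable (fun z : ℝ × (ℝ × ℝ) => riK z.2.1 z.1 * riK z.2.2 z.1)
      ((volume : Measure ℝ).prod ((riN T).prod (riN T))) := by
  have hm : Measurable (fun z : ℝ × (ℝ × ℝ) => riK z.2.1 z.1 * riK z.2.2 z.1) :=
    (ri_meas_K.comp (by fun_prop : Measurable fun z : ℝ × (ℝ × ℝ) => (z.2.1, z.1))).mul
    (ri_meas_K.comp (by fun_prop : Measurable fun z : ℝ × (ℝ × ℝ) => (z.2.2, z.1)))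
  rw [integrable_prod_iff' hm.aestronglyMeasurable]
  constructor
  · filter_upwards [ri_ae_pos_prod T] with q hq
    exact ri_KK_int hq.1 hq.2
  · refine ((ri_time_int hT).const_mul (1 / (4 * √(2 * π)))).congr ?_
    filter_upwards [ri_ae_pos_prod T] with q hq
    rw [← ri_KK_integral hq.1 hq.2]
    congr 1; ext v
    rw [Real.norm_of_nonneg (ri_KK_nonneg hq.1 hq.2 v)]

lemma ri_G_sq (T v : ℝ) :
    ∫ q : ℝ × ℝ, riK q.1 v * riK q.2 v ∂((riN T).prod (riN T)) = riG T v ^ 2 := by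
  rw [integral_prod_mul (fun s => riK s v) (fun s => riK s v), sq]; rfl

lemma ri_G_sq_int {T : ℝ} (hT : 0 < T) : Integrable (fun v => riG T v ^ 2) := by
  have := (ri_triple hT).integral_prod_left
  simpa only [ri_G_sq] using this

lemma ri_G_memLp {T : ℝ} (hT : 0 < T) : MemLp (riG T) 2 := by
  rw [memLp_two_iff_integrable_sq]
  · exact ri_G_sq_int hT
  · have : StronglyMeasurable (fun v => ∫ s, riK s v ∂(riN T)) :=
      ri_meas_K.stronglyMeasurable.integral_prod_left'
    exact this.aestronglyMeasurable

lemma ri_G_sq_integral {T : ℝ} (hT : 0 < T) :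
    ∫ v, riG T v ^ 2 = √T * (2 - √2) / √(2 * π) := by
  have h := integral_prod _ (ri_triple hT)
  simp only [ri_G_sq] at h
  rw [← h, integral_prod_symm _ (ri_triple hT)]
  have : ∫ q : ℝ × ℝ, (∫ v, riK q.1 v * riK q.2 v) ∂((riN T).prod (riN T))
      = ∫ q : ℝ × ℝ, 1 / (4 * √(2 * π)) * (q.1 + q.2) ^ (-(3/2) : ℝ) ∂((riN T).prod (riN T)) := by
    refine integral_congr_ae ?_
    filter_upwards [ri_ae_pos_prod T] with q hq
    rw [ri_KK_integral hq.1 hq.2]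
  rw [this, integral_const_mul, ri_time_integral hT]
  field_simp

lemma ri_total {T : ℝ} (hT : 0 < T) :
    (∫ v, riG T v ^ 2) + ∫ q : ℝ × ℝ, heatK (T - q.1) q.2 ^ 2 ∂((riN T).prod volume)
      = 2 * √T / √(2 * π) := by
  rw [ri_G_sq_integral hT, ri_p_integral hT, Real.sqrt_mul (by norm_num : (0:ℝ) ≤ 2) π]
  field_simp
  ring

/-! ### The current as a pairing -/

lemma ri_deriv_cpt {H : ℝ → ℝ → ℝ} (hH : HasCompactSupport fun q : ℝ × ℝ => H q.1 q.2) :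
    HasCompactSupport fun q : ℝ × ℝ => deriv (H q.1) q.2 := by
  refine hH.mono' ?_
  intro q hq
  by_contra hn
  apply hq
  have h0 := notMem_tsupport_iff_eventuallyEq.1 hn
  have hcont : Filter.Tendsto (fun u : ℝ => (q.1, u)) (nhds q.2) (nhds q) := by
    have : Continuous (fun u : ℝ => (q.1, u)) := by fun_prop
    exact this.tendsto q.2
  have h1 : H q.1 =ᶠ[nhds q.2] fun _ => 0 := hcont.eventually h0
  simpa using h1.deriv_eq

lemma ri_p_memLp {T : ℝ} (hT : 0 < T) :
    MemLp (fun q : ℝ × ℝ => heatK (T - q.1) q.2) 2 ((riN T).prod volume) :=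
  (memLp_two_iff_integrable_sq (ri_meas_heatK_sub T).aestronglyMeasurable).2 (ri_p_int hT)

lemma ri_h_memLp {T : ℝ} {h : ℝ × ℝ → ℝ} (hc : Continuous h) (hs : HasCompactSupport h) :
    MemLp h 2 ((riN T).prod volume) :=
  hc.memLp_of_hasCompactSupport hs

lemma ri_Kpsi_int {T : ℝ} (hT : 0 < T) {ψ : ℝ → ℝ} (hc : Continuous ψ) (hs : HasCompactSupport ψ) :
    Integrable (fun q : ℝ × ℝ => riK q.1 q.2 * ψ q.2) ((riN T).prod volume) := by
  obtain ⟨C, hC⟩ := hs.exists_bound_of_continuous hc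
  exact (ri_Kprod_int hT).mul_bdd (c := C) (by fun_prop) (.of_forall fun q => hC q.2)

lemma ri_current {T : ℝ} (hT : 0 < T) (χ : ℝ) {ψ : ℝ → ℝ} {H : ℝ → ℝ → ℝ}
    (hc : Continuous ψ) (hs : HasCompactSupport ψ)
    (hHc : Continuous fun q : ℝ × ℝ => deriv (H q.1) q.2)
    (hHs : HasCompactSupport fun q : ℝ × ℝ => deriv (H q.1) q.2) :
    netCurrent χ T ψ H = (∫ v, riG T v * ψ v) +
      χ * ∫ q : ℝ × ℝ, heatK (T - q.1) q.2 * deriv (H q.1) q.2 ∂((riN T).prod volume) := by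
  have i1 := ri_Kpsi_int hT hc hs
  have i2 : Integrable (fun q : ℝ × ℝ => heatK (T - q.1) q.2 * deriv (H q.1) q.2)
      ((riN T).prod volume) := (ri_p_memLp hT).integrable_mul (ri_h_memLp hHc hHs)
  have h1 : netCurrent χ T ψ H = ∫ q : ℝ × ℝ, (riK q.1 q.2 * ψ q.2 +
      χ * (heatK (T - q.1) q.2 * deriv (H q.1) q.2)) ∂((riN T).prod volume) := by
    have i3 : Integrable (fun q : ℝ × ℝ => riK q.1 q.2 * ψ q.2 +
      χ * (heatK (T - q.1) q.2 * deriv (H q.1) q.2)) ((riN T).prod volume) :=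
      i1.add (i2.const_mul χ)
    rw [integral_prod _ i3]
    unfold netCurrent
    rw [intervalIntegral.integral_of_le hT.le]
    simp only [riK, mul_assoc]
  rw [h1, integral_add i1 (i2.const_mul χ), integral_const_mul, integral_prod_symm _ i1]
  congr 1
  congr 1; ext v
  simp only [riG]
  rw [integral_mul_const]

lemma ri_energy {T : ℝ} (hT : 0 < T) {H : ℝ → ℝ → ℝ}
    (hHc : Continuous fun q : ℝ × ℝ => deriv (H q.1) q.2)
    (hHs : HasCompactSupport fun q : ℝ × ℝ => deriv (H q.1) q.2) :
    ∫ t in (0:ℝ)..T, ∫ u, (deriv (H t) u) ^ 2 =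
      ∫ q : ℝ × ℝ, deriv (H q.1) q.2 ^ 2 ∂((riN T).prod volume) := by
  rw [integral_prod _ (ri_h_memLp hHc hHs).integrable_sq, intervalIntegral.integral_of_le hT.le]

lemma ri_quad {X : Type*} [MeasurableSpace X] {μ : Measure X} {f g : X → ℝ}
    (hf : MemLp f 2 μ) (hg : MemLp g 2 μ) (c : ℝ) :
    0 ≤ (∫ x, f x ^ 2 ∂μ) - 2 * c * (∫ x, g x * f x ∂μ) + c ^ 2 * ∫ x, g x ^ 2 ∂μ := by
  have h : 0 ≤ ∫ x, (f x - c * g x) ^ 2 ∂μ := integral_nonneg fun x => sq_nonneg _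
  have e : ∀ x, (f x - c * g x) ^ 2 = (f x ^ 2 - 2 * c * (g x * f x)) + c ^ 2 * g x ^ 2 := by
    intro x; ring
  have hgf : Integrable (fun x => g x * f x) μ := hg.integrable_mul hf
  simp_rw [e] at h
  have i3 : Integrable (fun x => f x ^ 2 - 2 * c * (g x * f x)) μ :=
    hf.integrable_sq.sub (hgf.const_mul _)
  rwa [integral_add i3 (hg.integrable_sq.const_mul _),
    integral_sub hf.integrable_sq (hgf.const_mul _), integral_const_mul, integral_const_mul] at h

lemma ri_lower {T : ℝ} (hT : 0 < T) {χ α : ℝ} (hχ : 0 < χ) {ψ : ℝ → ℝ} {H : ℝ → ℝ → ℝ}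
    (hc : Continuous ψ) (hs : HasCompactSupport ψ)
    (hHc : Continuous fun q : ℝ × ℝ => deriv (H q.1) q.2)
    (hHs : HasCompactSupport fun q : ℝ × ℝ => deriv (H q.1) q.2)
    (hα : netCurrent χ T ψ H = α) :
    Real.sqrt (2 * π) * α ^ 2 / (4 * χ * Real.sqrt T) ≤ (∫ u, (ψ u) ^ 2) / (2 * χ) +
          (χ / 2) * ∫ t in (0:ℝ)..T, ∫ u, (deriv (H t) u) ^ 2 := by
  rw [ri_energy hT hHc hHs]
  rw [ri_current hT χ hc hs hHc hHs] at hα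
  have htot := ri_total hT
  set N := 2 * √T / √(2 * π) with hN
  have hNpos : 0 < N := by positivity
  have q1 := ri_quad (hc.memLp_of_hasCompactSupport (μ := volume) (p := 2) hs) (ri_G_memLp hT) (α / N)
  have q2 := ri_quad (ri_h_memLp (T := T) hHc hHs) (ri_p_memLp hT) (α / N / χ)
  set A := ∫ v, riG T v * ψ v
  set B := ∫ q : ℝ × ℝ, heatK (T - q.1) q.2 * deriv (H q.1) q.2 ∂((riN T).prod volume)
  set P := ∫ v, ψ v ^ 2
  set Q := ∫ q : ℝ × ℝ, deriv (H q.1) q.2 ^ 2 ∂((riN T).prod volume)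
  set Y := ∫ v, riG T v ^ 2
  set Z := ∫ q : ℝ × ℝ, heatK (T - q.1) q.2 ^ 2 ∂((riN T).prod volume)
  have e : Real.sqrt (2 * π) * α ^ 2 / (4 * χ * Real.sqrt T) = α ^ 2 / N / (2 * χ) := by
    rw [hN]; field_simp; ring
  have e2 : P / (2 * χ) + χ / 2 * Q = (P + χ ^ 2 * Q) / (2 * χ) := by field_simp
  rw [e, e2]
  gcongr
  have q2' : 0 ≤ χ ^ 2 * Q - 2 * (α / N) * (χ * B) + (α / N) ^ 2 * Z := by
    have := mul_nonneg (sq_nonneg χ) q2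
    calc _ ≤ _ := this
      _ = _ := by field_simp
  have : α ^ 2 / N = 2 * (α / N) * (A + χ * B) - (α / N) ^ 2 * (Y + Z) := by
    rw [hα, htot]; field_simp; ring
  rw [this]
  nlinarith

/-! ### Approximation of `g_T` -/

lemma ri_inner_toLp {X : Type*} [MeasurableSpace X] {μ : Measure X} {f g : X → ℝ}
    (hf : MemLp f 2 μ) (hg : MemLp g 2 μ) :
    inner ℝ (hf.toLp f) (hg.toLp g) = ∫ x, f x * g x ∂μ := by
  rw [L2.inner_def]
  refine integral_congr_ae ?_
  filter_upwards [hf.coeFn_toLp, hg.coeFn_toLp] with x h1 h2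
  rw [h1, h2]; simp [mul_comm]

lemma ri_approx_G {T : ℝ} (hT : 0 < T) : ∃ ψ : ℕ → ℝ → ℝ,
    (∀ n, ContDiff ℝ 2 (ψ n)) ∧ (∀ n, HasCompactSupport (ψ n)) ∧
    Filter.Tendsto (fun n => ∫ v, riG T v * ψ n v) Filter.atTop (nhds (∫ v, riG T v ^ 2)) ∧
    Filter.Tendsto (fun n => ∫ v, ψ n v ^ 2) Filter.atTop (nhds (∫ v, riG T v ^ 2)) := by
  have hG := ri_G_memLp hT
  have hex : ∀ n : ℕ, ∃ f : ℝ → ℝ, HasCompactSupport f ∧ ContDiff ℝ (⊤ : ℕ∞) f ∧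
      eLpNorm (riG T - f) 2 volume ≤ ENNReal.ofReal (1 / ((n:ℝ) + 1)) := fun n =>
    MemLp.exist_eLpNorm_sub_le (by simp) (by norm_num) hG (by positivity)
  choose ψ h1 h2 h3 using hex
  have hm : ∀ n, MemLp (ψ n) 2 := fun n => (h2 n).continuous.memLp_of_hasCompactSupport (h1 n)
  have hlim : Filter.Tendsto (fun n => (hm n).toLp (ψ n)) Filter.atTop (nhds (hG.toLp (riG T))) := by
    rw [tendsto_iff_norm_sub_tendsto_zero]
    refine squeeze_zero (fun _ => norm_nonneg _) (fun n => ?_) tendsto_one_div_add_atTop_nhds_zero_nat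
    rw [norm_sub_rev, ← MemLp.toLp_sub, Lp.norm_toLp]
    exact ENNReal.toReal_le_of_le_ofReal (by positivity) (h3 n)
  refine ⟨ψ, fun n => contDiff_infty.1 (h2 n) 2, h1, ?_, ?_⟩
  · have := (tendsto_const_nhds (x := hG.toLp (riG T))).inner (𝕜 := ℝ) hlim
    simp only [ri_inner_toLp] at this
    simpa only [← sq] using this
  · have := hlim.inner (𝕜 := ℝ) hlim
    simp only [ri_inner_toLp] at this
    simpa only [← sq] using this

/-! ### Smooth test functions -/

lemma ri_partial_u {n : ℕ} {Φ : ℝ × ℝ → ℝ} (hΦ : ContDiff ℝ (n + 1 : ℕ) Φ) :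
    ContDiff ℝ n (fun q : ℝ × ℝ => deriv (fun u => Φ (q.1, u)) q.2) := by
  have e : (fun q : ℝ × ℝ => deriv (fun u => Φ (q.1, u)) q.2) = fun q => fderiv ℝ Φ q (0, 1) := by
    ext q
    have hd : HasFDerivAt Φ (fderiv ℝ Φ q) (q.1, q.2) :=
      (hΦ.differentiable (by simp) q).hasFDerivAt
    have hl : HasDerivAt (fun u : ℝ => (q.1, u)) ((0, 1) : ℝ × ℝ) q.2 :=
      (hasDerivAt_const q.2 q.1).prodMk (hasDerivAt_id q.2)
    exact (hd.comp_hasDerivAt q.2 hl).deriv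
  rw [e]
  exact (hΦ.fderiv_right (m := n) (by norm_cast)).clm_apply contDiff_const

lemma ri_partial_t {Φ : ℝ × ℝ → ℝ} (hΦ : ContDiff ℝ 2 Φ) :
    Continuous (fun q : ℝ × ℝ => deriv (fun t => Φ (t, q.2)) q.1) := by
  have e : (fun q : ℝ × ℝ => deriv (fun t => Φ (t, q.2)) q.1) = fun q => fderiv ℝ Φ q (1, 0) := by
    ext q
    have hd : HasFDerivAt Φ (fderiv ℝ Φ q) (q.1, q.2) :=
      (hΦ.differentiable (by simp) q).hasFDerivAt
    have hl : HasDerivAt (fun t : ℝ => (t, q.2)) ((1, 0) : ℝ × ℝ) q.1 :=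
      (hasDerivAt_id q.1).prodMk (hasDerivAt_const q.1 q.2)
    exact (hd.comp_hasDerivAt q.1 hl).deriv
  rw [e]
  exact (hΦ.continuous_fderiv (by simp)).clm_apply continuous_const

/-- `C^{1,2}` regularity from joint `C²` regularity. -/
lemma ri_regular {H : ℝ → ℝ → ℝ} (hΦ : ContDiff ℝ 2 (fun q : ℝ × ℝ => H q.1 q.2)) :
        (∀ u, ContDiff ℝ 1 fun t => H t u) ∧
        (∀ t, ContDiff ℝ 2 fun u => H t u) ∧
        (Continuous fun q : ℝ × ℝ => deriv (fun t => H t q.2) q.1) ∧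
        (Continuous fun q : ℝ × ℝ => deriv (H q.1) q.2) ∧
        (Continuous fun q : ℝ × ℝ => deriv (deriv (H q.1)) q.2) ∧
        (Continuous fun q : ℝ × ℝ => H q.1 q.2) := by
  have h1 := ri_partial_u (n := 1) hΦ
  have h2 := ri_partial_u (n := 0) h1
  refine ⟨fun u => ?_, fun t => ?_, ri_partial_t hΦ, h1.continuous, h2.continuous, hΦ.continuous⟩
  · exact (hΦ.comp (contDiff_id.prodMk contDiff_const : ContDiff ℝ 2 fun t : ℝ => (t, u))).of_le
      (by norm_num)
  · exact hΦ.comp (contDiff_const.prodMk contDiff_id : ContDiff ℝ 2 fun u : ℝ => (t, u))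

/-! ### Approximation of the heat kernel -/

/-- Centred Gaussian distribution function. -/
noncomputable def riF (x : ℝ) : ℝ := ∫ y in (0:ℝ)..x, heatK 1 y

lemma ri_heat_one_smooth : ContDiff ℝ (⊤ : ℕ∞) (heatK 1) := by
  unfold heatK
  fun_prop

lemma ri_F_deriv (x : ℝ) : HasDerivAt riF (heatK 1 x) x :=
  intervalIntegral.integral_hasDerivAt_right (ri_heat_one_smooth.continuous.intervalIntegrable _ _)
    (ri_heat_one_smooth.continuous.stronglyMeasurableAtFilter _ _)
    ri_heat_one_smooth.continuous.continuousAt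

lemma ri_F_smooth : ContDiff ℝ 2 riF := by
  have h : ContDiff ℝ (1 + 1) riF := by
    rw [contDiff_succ_iff_deriv]
    refine ⟨fun x => (ri_F_deriv x).differentiableAt, by simp, ?_⟩
    rw [show deriv riF = heatK 1 from funext fun x => (ri_F_deriv x).deriv]
    exact ri_heat_one_smooth.of_le (by exact_mod_cast le_top)
  rwa [show (1 + 1 : WithTop ℕ∞) = 2 by norm_num] at h

lemma ri_F_bound : ∃ C, ∀ x, |riF x| ≤ C := by
  have hi : Integrable (heatK 1) := by
    have := (integrable_exp_neg_mul_sq (b := 1 / 2) (by norm_num)).const_mul (1 / √(2 * π * 1))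
    refine this.congr (.of_forall fun x => ?_)
    simp only [heatK]
    rw [one_div_mul_eq_div]; congr 2; ring
  refine ⟨∫ x, |heatK 1 x|, fun x => ?_⟩
  unfold riF
  rw [← Real.norm_eq_abs]
  refine (intervalIntegral.norm_integral_le_integral_norm_uIoc).trans ?_
  exact setIntegral_le_integral hi.norm (.of_forall fun _ => norm_nonneg _)

/-- Spatial cutoff profile. -/
noncomputable def riB (x : ℝ) : ℝ := Real.smoothTransition (2 - x ^ 2)

/-- Time cutoff. -/
noncomputable def riTh (T n s : ℝ) : ℝ :=
  Real.smoothTransition (n * (T - s) - 1) * Real.smoothTransition (s + 2)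

/-- Approximating potentials. -/
noncomputable def riH (T n s u : ℝ) : ℝ := riTh T n s * (riF (u / √(T - s)) * riB (u / n))

lemma ri_st_smooth : ContDiff ℝ 2 Real.smoothTransition :=
  Real.smoothTransition.contDiff (n := 2)

lemma ri_B_smooth : ContDiff ℝ 2 riB :=
  ri_st_smooth.comp (by fun_prop)

lemma ri_Th_smooth (T n : ℝ) : ContDiff ℝ 2 (riTh T n) :=
  (ri_st_smooth.comp (by fun_prop : ContDiff ℝ 2 fun s : ℝ => n * (T - s) - 1)).mul
    (ri_st_smooth.comp (by fun_prop : ContDiff ℝ 2 fun s : ℝ => s + 2))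

lemma ri_B_cpt : HasCompactSupport riB := by
  refine HasCompactSupport.intro (K := Set.Icc (-2) 2) isCompact_Icc fun x hx => ?_
  refine Real.smoothTransition.zero_of_nonpos ?_
  by_contra h
  exact hx ⟨by nlinarith, by nlinarith⟩

lemma ri_H_smooth (T : ℝ) {n : ℝ} (hn : 0 < n) :
    ContDiff ℝ 2 (fun q : ℝ × ℝ => riH T n q.1 q.2) := by
  rw [contDiff_iff_contDiffAt]
  intro q
  by_cases hq : q.1 < T
  · have h1 : ContDiffAt ℝ 2 (fun q : ℝ × ℝ => q.2 / √(T - q.1)) q := by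
      have hpos : 0 < T - q.1 := by linarith
      exact contDiffAt_snd.div ((contDiffAt_const.sub contDiffAt_fst).sqrt hpos.ne')
        (by positivity)
    have h2 : ContDiff ℝ 2 (fun q : ℝ × ℝ => q.2 / n) := contDiff_snd.div_const n
    exact ((ri_Th_smooth T n).comp contDiff_fst).contDiffAt.mul
      ((ri_F_smooth.contDiffAt.comp q h1).mul (ri_B_smooth.comp h2).contDiffAt)
  · have h0 : (fun q : ℝ × ℝ => riH T n q.1 q.2) =ᶠ[nhds q] fun _ => 0 := by
      have : ∀ᶠ p : ℝ × ℝ in nhds q, T - 1 / n < p.1 := by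
        refine continuous_fst.continuousAt.eventually (lt_mem_nhds ?_)
        have : 0 < 1 / n := by positivity
        linarith
      filter_upwards [this] with p hp
      have : Real.smoothTransition (n * (T - p.1) - 1) = 0 := by
        refine Real.smoothTransition.zero_of_nonpos ?_
        have : T - p.1 < 1 / n := by linarith
        rw [lt_div_iff₀ hn] at this
        linarith
      simp [riH, riTh, this]
    exact contDiffAt_const.congr_of_eventuallyEq h0

lemma ri_H_cpt (T : ℝ) {n : ℝ} (hn : 0 < n) :
    HasCompactSupport (fun q : ℝ × ℝ => riH T n q.1 q.2) := by
  refine HasCompactSupport.intro (K := Set.Icc (-2) T ×ˢ Set.Icc (-(2 * n)) (2 * n))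
    (isCompact_Icc.prod isCompact_Icc) fun q hq => ?_
  by_contra h
  simp only [riH, riTh, mul_eq_zero, not_or] at h
  obtain ⟨⟨h1, h2⟩, -, h3⟩ := h
  rw [Real.smoothTransition.zero_iff_nonpos, not_le] at h1 h2
  rw [riB, Real.smoothTransition.zero_iff_nonpos, not_le] at h3
  have h4 : (q.2 / n) ^ 2 < 2 ^ 2 := by linarith
  have h5 := abs_lt_of_sq_lt_sq' h4 (by norm_num)
  rw [lt_div_iff₀ hn, div_lt_iff₀ hn] at h5
  refine hq ⟨⟨by linarith, ?_⟩, ⟨by linarith, by linarith⟩⟩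
  by_contra hc
  nlinarith

lemma ri_H_deriv {T n s : ℝ} (hs : s < T) (u : ℝ) :
    deriv (riH T n s) u = riTh T n s *
      (heatK (T - s) u * riB (u / n) + riF (u / √(T - s)) * (deriv riB (u / n) / n)) := by
  have hpos : 0 < T - s := by linarith
  have hr : 0 < √(T - s) := by positivity
  have h1 : HasDerivAt (fun u => riF (u / √(T - s))) (heatK 1 (u / √(T - s)) * (1 / √(T - s))) u :=
    (ri_F_deriv _).comp u ((hasDerivAt_id u).div_const _)
  have h2 : HasDerivAt (fun u => riB (u / n)) (deriv riB (u / n) * (1 / n)) u :=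
    ((ri_B_smooth.differentiable (by norm_num) _).hasDerivAt).comp u ((hasDerivAt_id u).div_const _)
  have e : heatK 1 (u / √(T - s)) * (1 / √(T - s)) = heatK (T - s) u := by
    unfold heatK
    rw [div_pow, Real.sq_sqrt hpos.le, Real.sqrt_mul (by positivity) (T - s)]
    simp only [mul_one]
    have : -(u ^ 2 / (T - s)) / 2 = -u ^ 2 / (2 * (T - s)) := by field_simp
    rw [this]
    field_simp
  rw [e] at h1
  refine ((h1.mul h2).const_mul (riTh T n s)).deriv.trans ?_
  ring

lemma ri_heat_nonneg (s u : ℝ) : 0 ≤ heatK s u := by unfold heatK; positivity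

lemma ri_B_deriv_bound : ∃ D, 0 ≤ D ∧ ∀ x, deriv riB x ^ 2 * (1 + x ^ 2) ≤ D := by
  have hc : Continuous (deriv riB) := ri_B_smooth.continuous_deriv (by norm_num)
  have hs : HasCompactSupport (deriv riB) := ri_B_cpt.deriv
  have hs2 : HasCompactSupport (fun x => deriv riB x * (deriv riB x * (1 + x ^ 2))) := hs.mul_right
  obtain ⟨D, hD⟩ := hs2.exists_bound_of_continuous (by fun_prop)
  refine ⟨D, (norm_nonneg _).trans (hD 0), fun x => ?_⟩
  refine le_trans (le_of_eq ?_) ((le_abs_self _).trans (hD x))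
  ring

lemma ri_H_deriv_bound : ∃ M : ℝ, 0 ≤ M ∧ ∀ T n s u : ℝ, s < T → 1 ≤ n →
    deriv (riH T n s) u ^ 2 ≤ 2 * heatK (T - s) u ^ 2 + M * (1 + u ^ 2)⁻¹ := by
  obtain ⟨C, hC⟩ := ri_F_bound
  obtain ⟨D, hD0, hD⟩ := ri_B_deriv_bound
  refine ⟨2 * (C ^ 2 * D), by positivity, fun T n s u hs hn => ?_⟩
  rw [ri_H_deriv hs]
  have t0 : 0 ≤ riTh T n s :=
    mul_nonneg (Real.smoothTransition.nonneg _) (Real.smoothTransition.nonneg _)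
  have t1 : riTh T n s ≤ 1 :=
    mul_le_one₀ (Real.smoothTransition.le_one _) (Real.smoothTransition.nonneg _)
      (Real.smoothTransition.le_one _)
  have b0 : 0 ≤ riB (u / n) := Real.smoothTransition.nonneg _
  have b1 : riB (u / n) ≤ 1 := Real.smoothTransition.le_one _
  have p0 := ri_heat_nonneg (T - s) u
  have n0 : 0 < n := by linarith
  set p := heatK (T - s) u
  have hF : riF (u / √(T - s)) ^ 2 ≤ C ^ 2 := by
    rw [← sq_abs]; have := hC (u / √(T - s)); gcongr
  have hE : (deriv riB (u / n) / n) ^ 2 ≤ D * (1 + u ^ 2)⁻¹ := by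
    rw [← div_eq_mul_inv, le_div_iff₀ (by positivity)]
    refine le_trans ?_ (hD (u / n))
    rw [div_pow, div_mul_eq_mul_div, mul_div_assoc]
    refine mul_le_mul_of_nonneg_left ?_ (sq_nonneg _)
    rw [div_pow, add_div]
    have : 1 / n ^ 2 ≤ 1 := by
      rw [div_le_one (by positivity)]; nlinarith
    linarith
  have hx : (p * riB (u / n)) ^ 2 ≤ p ^ 2 := by
    have : p * riB (u / n) ≤ p := mul_le_of_le_one_right p0 b1
    have h0 : 0 ≤ p * riB (u / n) := by positivity
    gcongr
  have hy : (riF (u / √(T - s)) * (deriv riB (u / n) / n)) ^ 2 ≤ C ^ 2 * (D * (1 + u ^ 2)⁻¹) := by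
    rw [mul_pow]; gcongr
  have hth : riTh T n s ^ 2 ≤ 1 := by
    have : riTh T n s ^ 2 ≤ 1 ^ 2 := by gcongr
    simpa using this
  set x := p * riB (u / n)
  set y := riF (u / √(T - s)) * (deriv riB (u / n) / n)
  calc (riTh T n s * (x + y)) ^ 2 = riTh T n s ^ 2 * (x + y) ^ 2 := by ring
    _ ≤ 1 * (x + y) ^ 2 := by gcongr
    _ ≤ 2 * x ^ 2 + 2 * y ^ 2 := by nlinarith [sq_nonneg (x - y)]
    _ ≤ 2 * p ^ 2 + 2 * (C ^ 2 * (D * (1 + u ^ 2)⁻¹)) := by gcongr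
    _ = _ := by ring

lemma ri_H_deriv_lim {T s : ℝ} (hs0 : 0 < s) (hs : s < T) (u : ℝ) :
    Filter.Tendsto (fun n : ℕ => deriv (riH T ((n:ℝ) + 1) s) u) Filter.atTop
      (nhds (heatK (T - s) u)) := by
  simp only [ri_H_deriv hs]
  have hN : Filter.Tendsto (fun n : ℕ => (n:ℝ) + 1) Filter.atTop Filter.atTop :=
    Filter.tendsto_atTop_add_const_right _ _ tendsto_natCast_atTop_atTop
  have hz : Filter.Tendsto (fun n : ℕ => u / ((n:ℝ) + 1)) Filter.atTop (nhds 0) :=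
    tendsto_const_nhds.div_atTop hN
  have h1 : Filter.Tendsto (fun n : ℕ => riTh T ((n:ℝ) + 1) s) Filter.atTop (nhds 1) := by
    refine tendsto_const_nhds.congr' ?_
    have : Filter.Tendsto (fun n : ℕ => ((n:ℝ) + 1) * (T - s)) Filter.atTop Filter.atTop :=
      hN.atTop_mul_const (by linarith)
    filter_upwards [this.eventually_ge_atTop 2] with n hn
    rw [riTh, Real.smoothTransition.one_of_one_le (by linarith),
      Real.smoothTransition.one_of_one_le (by linarith), mul_one]
  have h2 : Filter.Tendsto (fun n : ℕ => riB (u / ((n:ℝ) + 1))) Filter.atTop (nhds 1) := by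
    have h := (ri_B_smooth.continuous.tendsto 0).comp hz
    have e : riB 0 = 1 := Real.smoothTransition.one_of_one_le (by norm_num)
    rwa [e] at h
  have h3 : Filter.Tendsto (fun n : ℕ => deriv riB (u / ((n:ℝ) + 1)) / ((n:ℝ) + 1)) Filter.atTop
      (nhds 0) :=
    (((ri_B_smooth.continuous_deriv (by norm_num)).tendsto 0).comp hz).div_atTop hN
  have := h1.mul ((h2.const_mul (heatK (T - s) u)).add (h3.const_mul (riF (u / √(T - s)))))
  simpa using this

lemma ri_approx_p {T : ℝ} (hT : 0 < T) :
    Filter.Tendsto (fun n : ℕ => ∫ q : ℝ × ℝ, heatK (T - q.1) q.2 * deriv (riH T ((n:ℝ) + 1) q.1) q.2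
      ∂((riN T).prod volume)) Filter.atTop
      (nhds (∫ q : ℝ × ℝ, heatK (T - q.1) q.2 ^ 2 ∂((riN T).prod volume))) ∧
    Filter.Tendsto (fun n : ℕ => ∫ q : ℝ × ℝ, deriv (riH T ((n:ℝ) + 1) q.1) q.2 ^ 2
      ∂((riN T).prod volume)) Filter.atTop
      (nhds (∫ q : ℝ × ℝ, heatK (T - q.1) q.2 ^ 2 ∂((riN T).prod volume))) := by
  obtain ⟨M, hM0, hM⟩ := ri_H_deriv_bound
  have hae : ∀ᵐ q ∂((riN T).prod (volume : Measure ℝ)), 0 < q.1 ∧ q.1 < T :=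
    (Measure.quasiMeasurePreserving_fst (μ := riN T) (ν := (volume : Measure ℝ))).ae (ri_ae_pos T)
  have hI : Integrable (fun q : ℝ × ℝ => (1 + q.2 ^ 2)⁻¹) ((riN T).prod volume) := by
    have := (integrable_const (μ := riN T) (1:ℝ)).mul_prod integrable_inv_one_add_sq
    simpa using this
  have hcont : ∀ n : ℕ, Continuous (fun q : ℝ × ℝ => deriv (riH T ((n:ℝ) + 1) q.1) q.2) :=
    fun n => (ri_regular (ri_H_smooth T (by positivity))).2.2.2.1
  have hlim : ∀ᵐ q ∂((riN T).prod (volume : Measure ℝ)), Filter.Tendsto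
      (fun n : ℕ => deriv (riH T ((n:ℝ) + 1) q.1) q.2) Filter.atTop (nhds (heatK (T - q.1) q.2)) := by
    filter_upwards [hae] with q hq
    exact ri_H_deriv_lim hq.1 hq.2 q.2
  constructor
  · refine tendsto_integral_of_dominated_convergence
      (fun q => 3 * heatK (T - q.1) q.2 ^ 2 + M * (1 + q.2 ^ 2)⁻¹) (fun n => ?_)
      (((ri_p_int hT).const_mul 3).add (hI.const_mul M)) (fun n => ?_) ?_
    · exact ((ri_meas_heatK_sub T).aestronglyMeasurable).mul (hcont n).aestronglyMeasurable
    · filter_upwards [hae] with q hq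
      have h := hM T ((n:ℝ) + 1) q.1 q.2 hq.2 (by linarith [Nat.cast_nonneg (α := ℝ) n])
      rw [Real.norm_eq_abs, abs_le]
      constructor <;>
      nlinarith [sq_nonneg (heatK (T - q.1) q.2 - deriv (riH T ((n:ℝ) + 1) q.1) q.2),
        sq_nonneg (heatK (T - q.1) q.2 + deriv (riH T ((n:ℝ) + 1) q.1) q.2),
        sq_nonneg (heatK (T - q.1) q.2), sq_nonneg (deriv (riH T ((n:ℝ) + 1) q.1) q.2)]
    · filter_upwards [hlim] with q hq
      rw [sq]
      exact hq.const_mul _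
  · refine tendsto_integral_of_dominated_convergence
      (fun q => 2 * heatK (T - q.1) q.2 ^ 2 + M * (1 + q.2 ^ 2)⁻¹) (fun n => ?_)
      (((ri_p_int hT).const_mul 2).add (hI.const_mul M)) (fun n => ?_) ?_
    · exact ((hcont n).pow 2).aestronglyMeasurable
    · filter_upwards [hae] with q hq
      have h := hM T ((n:ℝ) + 1) q.1 q.2 hq.2 (by linarith [Nat.cast_nonneg (α := ℝ) n])
      rwa [Real.norm_of_nonneg (sq_nonneg _)]
    · filter_upwards [hlim] with q hq
      exact hq.pow 2

lemma ri_member {T χ : ℝ} (α : ℝ) (hT : 0 < T) (hχ : 0 < χ) {φ : ℝ → ℝ} {K : ℝ → ℝ → ℝ}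
    (hφ : ContDiff ℝ 2 φ) (hφs : HasCompactSupport φ)
    (hK : ContDiff ℝ 2 (fun q : ℝ × ℝ => K q.1 q.2))
    (hKs : HasCompactSupport (fun q : ℝ × ℝ => K q.1 q.2)) {A S : ℝ}
    (hA : A = (∫ v, riG T v * φ v) + ∫ q : ℝ × ℝ,
      heatK (T - q.1) q.2 * deriv (K q.1) q.2 ∂((riN T).prod volume))
    (hS : S = (∫ v, φ v ^ 2) + ∫ q : ℝ × ℝ, deriv (K q.1) q.2 ^ 2 ∂((riN T).prod volume))
    (hA0 : A ≠ 0) :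
    ∃ ψ : ℝ → ℝ, ∃ H : ℝ → ℝ → ℝ,
        ContDiff ℝ 2 ψ ∧ HasCompactSupport ψ ∧
        (∀ u, ContDiff ℝ 1 fun t => H t u) ∧
        (∀ t, ContDiff ℝ 2 fun u => H t u) ∧
        (Continuous fun q : ℝ × ℝ => deriv (fun t => H t q.2) q.1) ∧
        (Continuous fun q : ℝ × ℝ => deriv (H q.1) q.2) ∧
        (Continuous fun q : ℝ × ℝ => deriv (deriv (H q.1)) q.2) ∧
        (Continuous fun q : ℝ × ℝ => H q.1 q.2) ∧
        (HasCompactSupport fun q : ℝ × ℝ => H q.1 q.2) ∧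
        netCurrent χ T ψ H = α ∧
        (α / A) ^ 2 * S / (2 * χ) = (∫ u, (ψ u) ^ 2) / (2 * χ) +
          (χ / 2) * ∫ t in (0:ℝ)..T, ∫ u, (deriv (H t) u) ^ 2 := by
  set c := α / A with hc
  have s1 : ContDiff ℝ 2 (fun v => c * φ v) := contDiff_const.mul hφ
  have s2 : HasCompactSupport (fun v => c * φ v) := hφs.mul_left
  have s3 : ContDiff ℝ 2 (fun q : ℝ × ℝ => (fun s u => c / χ * K s u) q.1 q.2) :=
    contDiff_const.mul hK
  have s4 : HasCompactSupport (fun q : ℝ × ℝ => (fun s u => c / χ * K s u) q.1 q.2) := hKs.mul_left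
  obtain ⟨r1, r2, r3, r4, r5, r6⟩ :=
    ri_regular (H := fun s u => c / χ * K s u) s3
  have hd : ∀ s u, deriv (fun u => c / χ * K s u) u = c / χ * deriv (K s) u := fun s u =>
    deriv_const_mul_field _
  refine ⟨fun v => c * φ v, fun s u => c / χ * K s u, s1, s2, r1, r2, r3, r4, r5, r6, s4, ?_, ?_⟩
  · rw [ri_current hT χ s1.continuous s2 r4 (ri_deriv_cpt s4)]
    simp only [hd, mul_left_comm _ c, mul_left_comm _ (c / χ)]
    rw [integral_const_mul, integral_const_mul]
    have : α = c * A := by rw [hc]; field_simp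
    rw [this, hA]
    field_simp
  · rw [ri_energy hT r4 (ri_deriv_cpt s4)]
    simp only [hd, mul_pow]
    rw [integral_const_mul, integral_const_mul, hS]
    field_simp

/-- The infimum of `‖ψ‖²_{L²}/(2χ) + (χ/2)∫₀ᵀ∫(∂_u H)²` over `ψ ∈ C²_c(ℝ)` and
`H ∈ C^{1,2}_c([0,T]×ℝ)` with `𝒞(T; ψ, H) = α` equals `√(2π) α²/(4χ√T)`. -/
theorem rate_inf_current_at_T (T ρ χ α : ℝ) (hT : 0 < T) (hρ : ρ ∈ Set.Ioo (0:ℝ) 1)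
    (hχ : χ = ρ * (1 - ρ)) :
    sInf {y : ℝ | ∃ ψ : ℝ → ℝ, ∃ H : ℝ → ℝ → ℝ,
        ContDiff ℝ 2 ψ ∧ HasCompactSupport ψ ∧
        (∀ u, ContDiff ℝ 1 fun t => H t u) ∧
        (∀ t, ContDiff ℝ 2 fun u => H t u) ∧
        (Continuous fun q : ℝ × ℝ => deriv (fun t => H t q.2) q.1) ∧
        (Continuous fun q : ℝ × ℝ => deriv (H q.1) q.2) ∧
        (Continuous fun q : ℝ × ℝ => deriv (deriv (H q.1)) q.2) ∧
        (Continuous fun q : ℝ × ℝ => H q.1 q.2) ∧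
        (HasCompactSupport fun q : ℝ × ℝ => H q.1 q.2) ∧
        netCurrent χ T ψ H = α ∧
        y = (∫ u, (ψ u) ^ 2) / (2 * χ) +
          (χ / 2) * ∫ t in (0:ℝ)..T, ∫ u, (deriv (H t) u) ^ 2} =
      Real.sqrt (2 * π) * α ^ 2 / (4 * χ * Real.sqrt T) := by
  have hχ0 : 0 < χ := by
    rw [hχ]; exact mul_pos hρ.1 (by linarith [hρ.2])
  clear hχ hρ
  obtain ⟨ψ, hψ1, hψ2, hψ3, hψ4⟩ := ri_approx_G hT
  obtain ⟨hp1, hp2⟩ := ri_approx_p hT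
  have htot := ri_total hT
  have hA := hψ3.add hp1
  have hS := hψ4.add hp2
  rw [htot] at hA hS
  set N := 2 * √T / √(2 * π) with hN
  have hNpos : 0 < N := by positivity
  have e : Real.sqrt (2 * π) * α ^ 2 / (4 * χ * Real.sqrt T) = (α / N) ^ 2 * N / (2 * χ) := by
    rw [hN]; field_simp; ring
  set A : ℕ → ℝ := fun n => (∫ v, riG T v * ψ n v) + ∫ q : ℝ × ℝ,
    heatK (T - q.1) q.2 * deriv (riH T ((n:ℝ) + 1) q.1) q.2 ∂((riN T).prod volume) with hAdef
  set S : ℕ → ℝ := fun n => (∫ v, ψ n v ^ 2) + ∫ q : ℝ × ℝ,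
    deriv (riH T ((n:ℝ) + 1) q.1) q.2 ^ 2 ∂((riN T).prod volume) with hSdef
  have hlim : Filter.Tendsto (fun n => (α / A n) ^ 2 * S n / (2 * χ)) Filter.atTop
      (nhds (Real.sqrt (2 * π) * α ^ 2 / (4 * χ * Real.sqrt T))) := by
    rw [e]
    exact (((tendsto_const_nhds.div hA hNpos.ne').pow 2).mul hS).div_const _
  have hApos : ∀ᶠ n in Filter.atTop, 0 < A n := hA.eventually (lt_mem_nhds hNpos)
  have hmem := fun n (hn : 0 < A n) => ri_member α hT hχ0 (hψ1 n) (hψ2 n)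
    (ri_H_smooth T (n := (n:ℝ) + 1) (by positivity))
    (ri_H_cpt T (n := (n:ℝ) + 1) (by positivity)) (A := A n) (S := S n) rfl rfl hn.ne'
  refine IsGLB.csInf_eq ⟨?_, ?_⟩ ?_
  · rintro y ⟨ψ, H, c1, c2, -, -, -, c3, -, -, c4, c5, rfl⟩
    exact ri_lower hT hχ0 c1.continuous c2 c3 (ri_deriv_cpt c4) c5
  · intro b hb
    refine ge_of_tendsto hlim ?_
    filter_upwards [hApos] with n hn
    exact hb (hmem n hn)
  · obtain ⟨n, hn⟩ := hApos.exists
    exact ⟨_, hmem n hn⟩
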